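/- arXiv:2105.08580 — 2 statements merged into one kernel-verified Lean document; each statement's English description precedes it below -/
import Mathlib

section
/- Let l ≥ 1, e ∈ ℤ_{>1}, let λ = (λ^0,…,λ^{l−1}) be an l-partition and let s = (s_0,…,s_{l−1}) ∈ ℤ^l with s_0 ≤ s_1 ≤ ⋯ ≤ s_{l−1} ≤ s_0 + e. Fix m ∈ ℤ_{>0} with m + s_c ≥ 1 and λ^c_{m+s_c} = 0 for all c, and set X^c := {λ^c_j − j + s_c + 1 : 1 ≤ j ≤ m + s_c}. For x ∈ X^c set N_0(x) := #{t : c < t ≤ l−1, x ∉ X^t}, and for k ∈ ℤ_{>0} set N_k(x) := #{t : 0 ≤ t ≤ l−1, x − ke ∉ X^t and x − ke > −m}. Then the number of elements of the multiset H(λ) of charged hook lengths, counted with multiplicity, that are congruent to 0 modulo e equals ∑_{c=0}^{l−1} ∑_{x ∈ X^c} ∑_{k≥0} N_k(x) (only finitely many N_k(x) are nonzero). -/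
/-- A partition, encoded as a nonincreasing eventually-zero sequence of naturals;
`part i` is the `(i+1)`-st part `λ_{i+1}`. -/
structure IntPartition where
  part : ℕ → ℕ
  antitone : Antitone part
  eventually_zero : ∃ N : ℕ, ∀ i, N ≤ i → part i = 0

namespace IntPartition

/-- `conj p k` is the `(k+1)`-st part `λ'_{k+1} = #{I ≥ 1 : λ_I ≥ k+1}` of the conjugate. -/
noncomputable def conj (p : IntPartition) (k : ℕ) : ℕ :=
  Set.ncard {i : ℕ | k < p.part i}

end IntPartition

/-- Generalised hook length `h^{λ,μ}_{i+1,j+1} = λ_{i+1} - (i+1) + μ'_{j+1} - (j+1) + 1`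
of the (0-indexed) node `(i,j)`. -/
noncomputable def hookLen (p q : IntPartition) (i j : ℕ) : ℤ :=
  (p.part i : ℤ) + q.conj j - i - j - 1

/-- Charged hook length `ch^{a,b}_{c,d} = h^{λ^a,λ^b}_{c,d} + s_a - s_b` (0-indexed node). -/
noncomputable def chargedHook {l : ℕ} (lam : Fin l → IntPartition) (s : Fin l → ℤ)
    (a b : Fin l) (i j : ℕ) : ℤ :=
  hookLen (lam a) (lam b) i j + s a - s b

/-- The charged β-numbers `X = {λ_j − j + s + 1 : 1 ≤ j ≤ m + s}`. -/
def betaFinset (p : IntPartition) (s : ℤ) (m : ℕ) : Finset ℤ :=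
  (Finset.range ((m : ℤ) + s).toNat).image (fun j : ℕ => (p.part j : ℤ) - j + s)

/-- The abacus `L_s(λ) = {λ_j − j + s + 1 : j ∈ ℤ_{>0}}`. -/
def abacusSet (p : IntPartition) (s : ℤ) : Set ℤ :=
  {x : ℤ | ∃ j : ℕ, x = (p.part j : ℤ) - j + s}

/-- The set of rows meeting column `j` is an initial segment of length `conj j`. -/
theorem IntPartition.lt_conj_iff (p : IntPartition) (j k : ℕ) :
    k < p.conj j ↔ j < p.part k := by
  classical
  obtain ⟨N, hN⟩ := p.eventually_zero
  have hex : ∃ n, p.part n ≤ j := ⟨N, by simp [hN N le_rfl]⟩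
  have hset : {i : ℕ | j < p.part i} = Set.Iio (Nat.find hex) := by
    ext i
    simp only [Set.mem_ofPred_eq, Set.mem_Iio]
    constructor
    · intro h
      by_contra! hle
      exact absurd ((p.antitone hle).trans (Nat.find_spec hex)) (not_le.2 h)
    · intro h
      exact not_le.1 (Nat.find_min hex h)
  have hcard : p.conj j = Nat.find hex := by
    rw [IntPartition.conj, hset, ← Finset.coe_Iio, Set.ncard_coe_finset, Nat.card_Iio]
  have : k ∈ {i : ℕ | j < p.part i} ↔ k ∈ Set.Iio (Nat.find hex) := by rw [hset]
  rw [hcard]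
  exact this.symm

/-- The β-numbers of a charged partition are strictly decreasing. -/
theorem IntPartition.beta_strictAnti (p : IntPartition) (s : ℤ) :
    StrictAnti fun j : ℕ => (p.part j : ℤ) - j + s := by
  intro a b hab
  have h := p.antitone hab.le
  simp only
  omega

theorem mem_betaFinset {p : IntPartition} {s : ℤ} {m : ℕ} {x : ℤ} :
    x ∈ betaFinset p s m ↔ ∃ j : ℕ, (j : ℤ) < m + s ∧ (p.part j : ℤ) - j + s = x := by
  simp [betaFinset, Int.lt_toNat]

theorem card_betaFinset (p : IntPartition) (s : ℤ) (m : ℕ) :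
    (betaFinset p s m).card = ((m : ℤ) + s).toNat := by
  rw [betaFinset, Finset.card_image_of_injective _ (p.beta_strictAnti s).injective,
    Finset.card_range]

theorem neg_lt_of_mem_betaFinset {p : IntPartition} {s : ℤ} {m : ℕ} {x : ℤ}
    (hx : x ∈ betaFinset p s m) : -(m : ℤ) < x := by
  obtain ⟨j, hj, rfl⟩ := mem_betaFinset.1 hx
  omega

/-- The number of β-numbers that are at least `x`. -/
def betaCount (p : IntPartition) (s : ℤ) (m : ℕ) (x : ℤ) : ℕ :=
  ((betaFinset p s m).filter (x ≤ ·)).card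

theorem betaCount_eq_of_forall {p : IntPartition} {s : ℤ} {m : ℕ} {x : ℤ} {n : ℕ}
    (hn : (n : ℤ) ≤ m + s) (hlt : ∀ k < n, x ≤ (p.part k : ℤ) - k + s)
    (hge : ∀ k, n ≤ k → (p.part k : ℤ) - k + s < x) : betaCount p s m x = n := by
  have : (betaFinset p s m).filter (x ≤ ·) =
      (Finset.range n).image (fun j : ℕ => (p.part j : ℤ) - j + s) := by
    ext y
    simp only [Finset.mem_filter, mem_betaFinset, Finset.mem_image, Finset.mem_range]
    constructor
    · rintro ⟨⟨j, -, rfl⟩, hy⟩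
      refine ⟨j, ?_, rfl⟩
      by_contra! h
      exact absurd (hge j h) (not_lt.2 hy)
    · rintro ⟨j, hj, rfl⟩
      exact ⟨⟨j, by omega, rfl⟩, hlt j hj⟩
  rw [betaCount, this, Finset.card_image_of_injective _ (p.beta_strictAnti s).injective,
    Finset.card_range]

theorem betaCount_eq_succ (p : IntPartition) (s : ℤ) (m : ℕ) (x : ℤ) :
    betaCount p s m x = betaCount p s m (x + 1) + if x ∈ betaFinset p s m then 1 else 0 := by
  unfold betaCount
  split_ifs with h
  · rw [← Finset.card_insert_of_notMem (a := x) (by simp)]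
    congr 1
    ext y
    simp only [Finset.mem_filter, Finset.mem_insert]
    constructor
    · rintro ⟨hy, hxy⟩
      rcases hxy.eq_or_lt with rfl | hlt
      · exact Or.inl rfl
      · exact Or.inr ⟨hy, hlt⟩
    · rintro (rfl | ⟨hy, hxy⟩)
      · exact ⟨h, le_rfl⟩
      · exact ⟨hy, by omega⟩
  · rw [add_zero]
    congr 1
    ext y
    simp only [Finset.mem_filter]
    refine and_congr_right fun hy => ?_
    have : x ≠ y := fun hxy => h (hxy ▸ hy)
    omega

/-- The β-number of row `i` has exactly `i + 1` β-numbers weakly above it. -/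
theorem betaCount_beta {p : IntPartition} {s : ℤ} {m i : ℕ} (hi : (i : ℤ) < m + s) :
    betaCount p s m ((p.part i : ℤ) - i + s) = i + 1 := by
  refine betaCount_eq_of_forall (by push_cast; omega) (fun k hk => ?_) (fun k hk => ?_)
  · exact (p.beta_strictAnti s).antitone (Nat.lt_succ_iff.1 hk)
  · exact p.beta_strictAnti s (Nat.succ_le_iff.1 hk)

theorem conj_lt {p : IntPartition} {s : ℤ} {m : ℕ} (hms : 1 ≤ (m : ℤ) + s)
    (hzero : p.part (((m : ℤ) + s).toNat - 1) = 0) (j : ℕ) : (p.conj j : ℤ) < m + s := by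
  by_contra! h
  have := (p.lt_conj_iff j (((m : ℤ) + s).toNat - 1)).1 (by omega)
  omega

/-- The number attached to column `j` has exactly `conj j` β-numbers weakly above it. -/
theorem betaCount_gap {p : IntPartition} {s : ℤ} {m : ℕ} (hms : 1 ≤ (m : ℤ) + s)
    (hzero : p.part (((m : ℤ) + s).toNat - 1) = 0) (j : ℕ) :
    betaCount p s m ((j : ℤ) + 1 - p.conj j + s) = p.conj j := by
  refine betaCount_eq_of_forall (conj_lt hms hzero j).le (fun k hk => ?_) (fun k hk => ?_)
  · have := (p.lt_conj_iff j k).1 hk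
    omega
  · have := mt (p.lt_conj_iff j k).2 (not_lt.2 hk)
    omega

theorem gap_notMem_betaFinset (p : IntPartition) (s : ℤ) (m j : ℕ) :
    (j : ℤ) + 1 - p.conj j + s ∉ betaFinset p s m := by
  intro h
  obtain ⟨k, -, hk⟩ := mem_betaFinset.1 h
  have := p.lt_conj_iff j k
  omega

theorem gap_strictMono (p : IntPartition) (s : ℤ) :
    StrictMono fun j : ℕ => (j : ℤ) + 1 - p.conj j + s := by
  intro a b hab
  have : p.conj b ≤ p.conj a := by
    by_contra! h
    have h₁ := (p.lt_conj_iff b _).1 h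
    have h₂ := p.lt_conj_iff a (p.conj a)
    omega
  simp only
  omega

/-- Every integer above `-m` that is not a β-number is the number of some column. -/
theorem exists_gap_eq {p : IntPartition} {s : ℤ} {m : ℕ} (hms : 1 ≤ (m : ℤ) + s)
    (hzero : p.part (((m : ℤ) + s).toNat - 1) = 0) {y : ℤ} (hy : y ∉ betaFinset p s m)
    (hym : -(m : ℤ) < y) : ∃ j : ℕ, (j : ℤ) + 1 - p.conj j + s = y := by
  classical
  have hlast : (p.part (((m : ℤ) + s).toNat - 1) : ℤ) - (((m : ℤ) + s).toNat - 1 : ℕ) + s < y := by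
    have hne : (p.part (((m : ℤ) + s).toNat - 1) : ℤ) - (((m : ℤ) + s).toNat - 1 : ℕ) + s ≠ y :=
      fun h => hy (mem_betaFinset.2 ⟨_, by omega, h⟩)
    omega
  have hex : ∃ n : ℕ, (p.part n : ℤ) - n + s < y := ⟨_, hlast⟩
  have hnlt := Nat.find_min' hex hlast
  have hspec := Nat.find_spec hex
  have hmin : ∀ k < Nat.find hex, y < (p.part k : ℤ) - k + s := fun k hk => by
    have h₁ := Nat.find_min hex hk
    have h₂ : (p.part k : ℤ) - k + s ≠ y := fun h => hy (mem_betaFinset.2 ⟨k, by omega, h⟩)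
    omega
  generalize Nat.find hex = n at *
  obtain ⟨j, hj⟩ : ∃ j : ℕ, (j : ℤ) = y - s + n - 1 :=
    ⟨(y - s + n - 1).toNat, by omega⟩
  refine ⟨j, ?_⟩
  have hconj : p.conj j = n := by
    apply le_antisymm
    · by_contra! h
      have := (p.lt_conj_iff j n).1 h
      omega
    · rcases Nat.eq_zero_or_pos n with rfl | hn
      · exact Nat.zero_le _
      · have h₁ := hmin (n - 1) (by omega)
        have h₂ := (p.lt_conj_iff j (n - 1)).2 (by omega)
        omega
  omega

/-- The number of nodes of `p` whose charged hook length with respect to `(p, q)` is `v`. -/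
noncomputable def hookCount (p q : IntPartition) (s t v : ℤ) : ℕ :=
  Set.ncard {x : ℕ × ℕ | x.2 < p.part x.1 ∧ hookLen p q x.1 x.2 + s - t = v}

/-- Nodes of charged hook length `v` correspond to β-numbers `x` of `p` with `x - v` a gap of `q`
satisfying a counting inequality. -/
theorem hookCount_eq_card {p q : IntPartition} {s t : ℤ} {m : ℕ}
    (hps : 1 ≤ (m : ℤ) + s) (hp : p.part (((m : ℤ) + s).toNat - 1) = 0)
    (hqt : 1 ≤ (m : ℤ) + t) (hq : q.part (((m : ℤ) + t).toNat - 1) = 0) (v : ℤ) :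
    hookCount p q s t v = ((betaFinset p s m).filter fun x =>
      (x - v ∉ betaFinset q t m ∧ -(m : ℤ) < x - v) ∧
        (betaCount q t m (x - v) : ℤ) - betaCount p s m x < v + t - s).card := by
  have hrow : ∀ {i j : ℕ}, j < p.part i → (i : ℤ) < m + s := fun {i j} h => by
    by_contra! hle
    have := p.antitone (show ((m : ℤ) + s).toNat - 1 ≤ i by omega)
    omega
  have hgap : ∀ {i j : ℕ}, hookLen p q i j + s - t = v →
      (p.part i : ℤ) - i + s - v = (j : ℤ) + 1 - q.conj j + t := fun {i j} h => by
    unfold hookLen at h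
    omega
  rw [hookCount, ← Set.ncard_coe_finset]
  refine Set.ncard_congr (fun x _ => (p.part x.1 : ℤ) - x.1 + s) ?_ ?_ ?_
  · rintro ⟨i, j⟩ ⟨hij, hv⟩
    simp only at hij hv ⊢
    simp only [Finset.coe_filter, Set.mem_ofPred_eq]
    have hi := hrow hij
    rw [hgap hv, betaCount_gap hqt hq, betaCount_beta hi]
    refine ⟨mem_betaFinset.2 ⟨i, hi, rfl⟩, ⟨gap_notMem_betaFinset q t m j, ?_⟩, ?_⟩
    · have := conj_lt hqt hq j
      omega
    · unfold hookLen at hv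
      push_cast
      omega
  · rintro ⟨i, j⟩ ⟨i', j'⟩ ⟨-, hv⟩ ⟨-, hv'⟩ h
    simp only at h hv hv'
    have hi : i = i' := (p.beta_strictAnti s).injective h
    subst hi
    have hj : j = j' := (gap_strictMono q t).injective ((hgap hv).symm.trans (hgap hv'))
    rw [hj]
  · intro x hx
    simp only [Finset.coe_filter, Set.mem_ofPred_eq] at hx
    obtain ⟨hxp, ⟨hxq, hxm⟩, hlt⟩ := hx
    obtain ⟨i, hi, rfl⟩ := mem_betaFinset.1 hxp
    obtain ⟨j, hj⟩ := exists_gap_eq hqt hq hxq hxm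
    rw [← hj, betaCount_gap hqt hq, betaCount_beta hi] at hlt
    push_cast at hlt
    refine ⟨(i, j), ⟨?_, ?_⟩, rfl⟩
    · simp only
      omega
    · simp only [hookLen]
      omega

/-- The β-numbers `x` of `p` such that `x - v` is a gap of `q` above `-m`. -/
def pairFinset (p q : IntPartition) (s t : ℤ) (m : ℕ) (v : ℤ) : Finset ℤ :=
  (betaFinset p s m).filter fun x => x - v ∉ betaFinset q t m ∧ -(m : ℤ) < x - v

/-- Symmetrised count of charged hooks of a given length. -/
theorem hookCount_add_hookCount_neg {p q : IntPartition} {s t : ℤ} {m : ℕ}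
    (hps : 1 ≤ (m : ℤ) + s) (hp : p.part (((m : ℤ) + s).toNat - 1) = 0)
    (hqt : 1 ≤ (m : ℤ) + t) (hq : q.part (((m : ℤ) + t).toNat - 1) = 0) {v : ℤ}
    (hv : 0 ≤ v) (hw : 0 ≤ v + t - s) :
    hookCount p q s t v + hookCount q p t s (-v) = (pairFinset p q s t m v).card := by
  classical
  set D : ℤ → ℤ := fun x => (betaCount q t m (x - v) : ℤ) - betaCount p s m x with hD
  obtain ⟨n, hn⟩ : ∃ n : ℕ, ∀ x : ℤ, v - m + 1 + n ≤ x →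
      x ∉ betaFinset p s m ∧ x - v ∉ betaFinset q t m := by
    refine ⟨p.part 0 + q.part 0 + m + s.natAbs + t.natAbs, fun x hx => ⟨fun h => ?_, fun h => ?_⟩⟩
    · obtain ⟨j, -, hj⟩ := mem_betaFinset.1 h
      have := p.antitone (Nat.zero_le j)
      omega
    · obtain ⟨j, -, hj⟩ := mem_betaFinset.1 h
      have := q.antitone (Nat.zero_le j)
      omega
  set W : Finset ℤ := Finset.Ico (v - m + 1) (v - m + 1 + n) with hW
  have hWX : ∀ x, x ∈ betaFinset p s m → -(m : ℤ) < x - v → x ∈ W := fun x hx hxm => by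
    rw [hW, Finset.mem_Ico]
    refine ⟨by omega, ?_⟩
    by_contra! h
    exact (hn x h).1 hx
  have hWY : ∀ x, x - v ∈ betaFinset q t m → x ∈ W := fun x hx => by
    have := neg_lt_of_mem_betaFinset hx
    rw [hW, Finset.mem_Ico]
    refine ⟨by omega, ?_⟩
    by_contra! h
    exact (hn x h).2 hx
  have hstep : ∀ x, D (x + 1) = D x + (if x ∈ betaFinset p s m then 1 else 0)
      - (if x - v ∈ betaFinset q t m then 1 else 0) := fun x => by
    have h₁ := betaCount_eq_succ p s m x
    have h₂ := betaCount_eq_succ q t m (x - v)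
    simp only [hD, show x + 1 - v = x - v + 1 by ring]
    split_ifs at * <;> omega
  have hlow : D (v - m + 1) ≤ v + t - s := by
    have h₁ : betaCount q t m (v - m + 1 - v) ≤ ((m : ℤ) + t).toNat := by
      rw [← card_betaFinset q t m]
      exact Finset.card_filter_le _ _
    have h₂ : ((m : ℤ) + s).toNat ≤ betaCount p s m (v - m + 1) + v.toNat := by
      have hsub : betaFinset p s m ⊆
          (betaFinset p s m).filter (v - m + 1 ≤ ·) ∪ Finset.Ico (1 - (m : ℤ)) (v - m + 1) := by
        intro x hx
        have := neg_lt_of_mem_betaFinset hx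
        simp only [Finset.mem_union, Finset.mem_filter, Finset.mem_Ico]
        by_cases h : v - m + 1 ≤ x
        · exact Or.inl ⟨hx, h⟩
        · exact Or.inr ⟨by omega, by omega⟩
      have h := (Finset.card_le_card hsub).trans (Finset.card_union_le _ _)
      rw [card_betaFinset, Int.card_Ico] at h
      rw [betaCount]
      omega
    simp only [hD]
    omega
  have hhigh : D (v - m + 1 + n) ≤ v + t - s := by
    have h₁ : betaCount q t m (v - m + 1 + n - v) = 0 := by
      rw [betaCount, Finset.card_eq_zero, Finset.filter_eq_empty_iff]
      intro x hx hle
      exact (hn (x + v) (by omega)).2 (by simpa using hx)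
    simp only [hD]
    omega
  have htel : ∑ x ∈ W, (max (D (x + 1) - (v + t - s)) 0 - max (D x - (v + t - s)) 0) = 0 := by
    have key : ∀ (f : ℤ → ℤ) (a : ℤ) (k : ℕ),
        ∑ x ∈ Finset.Ico a (a + k), (f (x + 1) - f x) = f (a + k) - f a := by
      intro f a k
      induction k with
      | zero => simp
      | succ k ih =>
        have : Finset.Ico a (a + (k + 1 : ℕ)) = insert (a + k : ℤ) (Finset.Ico a (a + k)) := by
          ext x
          simp only [Finset.mem_Ico, Finset.mem_insert]
          omega
        rw [this, Finset.sum_insert (by simp), ih]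
        push_cast
        rw [add_assoc]
        ring
    rw [hW, key (fun x => max (D x - (v + t - s)) 0)]
    omega
  have hbal : (W.filter fun x => (x ∈ betaFinset p s m ∧ x - v ∉ betaFinset q t m) ∧
        ¬ D x < v + t - s).card =
      (W.filter fun x => (x ∉ betaFinset p s m ∧ x - v ∈ betaFinset q t m) ∧
        v + t - s < D x).card := by
    zify
    rw [Finset.card_filter, Finset.card_filter, ← sub_eq_zero]
    push_cast
    rw [← Finset.sum_sub_distrib]
    refine Eq.trans (Finset.sum_congr rfl fun x _ => ?_) htel
    rw [hstep x]
    by_cases h₁ : x ∈ betaFinset p s m <;> by_cases h₂ : x - v ∈ betaFinset q t m <;>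
      simp only [h₁, h₂, if_true, if_false, true_and, false_and, not_true, not_false_eq_true] <;>
      (try split_ifs) <;> omega
  have hsecond : hookCount q p t s (-v) =
      (W.filter fun x => (x ∉ betaFinset p s m ∧ x - v ∈ betaFinset q t m) ∧
        v + t - s < D x).card := by
    rw [hookCount_eq_card hqt hq hps hp]
    refine Finset.card_bij (fun x _ => x + v) ?_ ?_ ?_
    · intro x hx
      simp only [Finset.mem_filter, sub_neg_eq_add] at hx ⊢
      obtain ⟨hxq, ⟨hxp, hxm⟩, hlt⟩ := hx
      refine ⟨hWY _ (by simpa using hxq), ⟨hxp, by simpa using hxq⟩, ?_⟩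
      simp only [hD, add_sub_cancel_right]
      omega
    · intro x _ y _ h
      exact add_right_cancel h
    · intro x hx
      simp only [Finset.mem_filter, hD] at hx
      obtain ⟨-, ⟨hxp, hxq⟩, hlt⟩ := hx
      have := neg_lt_of_mem_betaFinset hxq
      refine ⟨x - v, ?_, by ring⟩
      simp only [Finset.mem_filter, sub_neg_eq_add, sub_add_cancel]
      exact ⟨hxq, ⟨hxp, by omega⟩, by omega⟩
  have hsplit := Finset.card_filter_add_card_filter_not (s := pairFinset p q s t m v)
    (p := fun x => D x < v + t - s)
  rw [pairFinset, Finset.filter_filter, Finset.filter_filter] at hsplit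
  rw [hsecond, ← hbal, hookCount_eq_card hps hp hqt hq, pairFinset, ← hsplit]
  congr 2
  ext x
  simp only [Finset.mem_filter]
  constructor
  · rintro ⟨hx, ⟨hxp, hxq⟩, hlt⟩
    rw [hW, Finset.mem_Ico] at hx
    exact ⟨hxp, ⟨hxq, by omega⟩, hlt⟩
  · rintro ⟨hxp, ⟨hxq, hxm⟩, hlt⟩
    exact ⟨hWX x hxp hxm, ⟨hxp, hxq⟩, hlt⟩

theorem IntPartition.finite_nodes (p : IntPartition) :
    {x : ℕ × ℕ | x.2 < p.part x.1}.Finite := by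
  obtain ⟨N, hN⟩ := p.eventually_zero
  refine ((Finset.range N ×ˢ Finset.range (p.part 0)).finite_toSet).subset ?_
  rintro ⟨i, j⟩ (hij : j < p.part i)
  have h₀ := p.antitone (Nat.zero_le i)
  have hi : i < N := by
    by_contra! h
    have := hN i h
    omega
  simp only [Finset.coe_product, Finset.coe_range, Set.mem_prod, Set.mem_Iio]
  exact ⟨hi, by omega⟩

theorem sum_Icc_neg_eq {M : Type*} [AddCommMonoid M] (f : ℤ → M) (K : ℕ) :
    ∑ z ∈ Finset.Icc (-(K : ℤ)) K, f z =
      f 0 + ∑ k ∈ Finset.range K, (f ((k + 1 : ℕ) : ℤ) + f (-((k + 1 : ℕ) : ℤ))) := by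
  induction K with
  | zero => simp
  | succ K ih =>
    have : Finset.Icc (-((K + 1 : ℕ) : ℤ)) ((K + 1 : ℕ) : ℤ) =
        insert ((K + 1 : ℕ) : ℤ) (insert (-((K + 1 : ℕ) : ℤ)) (Finset.Icc (-(K : ℤ)) K)) := by
      ext x
      simp only [Finset.mem_Icc, Finset.mem_insert]
      omega
    rw [this, Finset.sum_insert, Finset.sum_insert, ih, Finset.sum_range_succ]
    · abel
    · simp only [Finset.mem_Icc]
      omega
    · simp only [Finset.mem_insert, Finset.mem_Icc]
      omega

/-- The nodes whose charged hook length is divisible by `e`, sorted by hook length. -/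
theorem exists_forall_ncard_dvd_eq_sum (p q : IntPartition) (s t : ℤ) {e : ℕ} (he : 0 < e) :
    ∃ K₀ : ℕ, ∀ K, K₀ ≤ K →
      Set.ncard {x : ℕ × ℕ | x.2 < p.part x.1 ∧ (e : ℤ) ∣ hookLen p q x.1 x.2 + s - t} =
        hookCount p q s t 0 + ∑ k ∈ Finset.range K,
          (hookCount p q s t ((k + 1 : ℕ) * e) + hookCount p q s t (-((k + 1 : ℕ) * e))) := by
  classical
  set F := p.finite_nodes.toFinset with hF
  set h : ℕ × ℕ → ℤ := fun x => hookLen p q x.1 x.2 + s - t with hh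
  have hcount : ∀ v, hookCount p q s t v = (F.filter fun x => h x = v).card := fun v => by
    rw [hookCount, ← Set.ncard_coe_finset]
    congr 1
    ext x
    simp [hF, hh]
  refine ⟨∑ x ∈ F, (h x).natAbs, fun K hK => ?_⟩
  have hset : {x : ℕ × ℕ | x.2 < p.part x.1 ∧ (e : ℤ) ∣ hookLen p q x.1 x.2 + s - t} =
      ((F.filter fun x => (e : ℤ) ∣ h x : Finset (ℕ × ℕ)) : Set (ℕ × ℕ)) := by
    ext x
    simp [hF, hh]
  have hmaps : Set.MapsTo (fun x => h x / e)
      ((F.filter fun x => (e : ℤ) ∣ h x : Finset (ℕ × ℕ)) : Set (ℕ × ℕ))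
      (Finset.Icc (-(K : ℤ)) K : Finset ℤ) := by
    intro x hx
    have hxF : x ∈ F := (Finset.mem_filter.1 hx).1
    have h₁ := (Finset.single_le_sum (f := fun x => (h x).natAbs)
      (fun _ _ => Nat.zero_le _) hxF).trans hK
    have h₂ : (h x / e).natAbs ≤ (h x).natAbs := Int.natAbs_ediv_le_natAbs _ _
    simp only [Finset.coe_Icc, Set.mem_Icc]
    omega
  have hsum := sum_Icc_neg_eq (fun z : ℤ => hookCount p q s t (z * e)) K
  simp only [zero_mul, neg_mul] at hsum
  rw [hset, Set.ncard_coe_finset, Finset.card_eq_sum_card_fiberwise hmaps, ← hsum]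
  refine Finset.sum_congr rfl fun z _ => ?_
  rw [hcount, Finset.filter_filter]
  congr 1
  ext x
  simp only [Finset.mem_filter]
  refine and_congr_right fun _ => ⟨fun ⟨hd, hz⟩ => ?_, fun hz => ?_⟩
  · rw [← hz, Int.ediv_mul_cancel hd]
  · rw [hz]
    exact ⟨Dvd.intro_left z rfl, Int.mul_ediv_cancel z (by positivity)⟩

theorem ncard_setOf_pair_eq_sum {ι α : Type*} [Fintype ι] (P : ι → ι → α → Prop)
    (hP : ∀ a b, {y | P a b y}.Finite) :
    Set.ncard {x : ι × ι × α | P x.1 x.2.1 x.2.2} = ∑ a, ∑ b, Set.ncard {y | P a b y} := by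
  let E : {x : ι × ι × α | P x.1 x.2.1 x.2.2} ≃ Σ c : ι × ι, {y | P c.1 c.2 y} :=
    { toFun := fun x => ⟨(x.1.1, x.1.2.1), x.1.2.2, x.2⟩
      invFun := fun z => ⟨(z.1.1, z.1.2, z.2.1), z.2.2⟩
      left_inv := fun _ => rfl
      right_inv := fun _ => rfl }
  have : ∀ c : ι × ι, Finite {y | P c.1 c.2 y} := fun c => hP c.1 c.2
  rw [← Nat.card_coe_set_eq, Nat.card_congr E, Nat.card_sigma, Fintype.sum_prod_type]
  rfl

theorem sum_sum_eq_of_add_swap_eq {ι : Type*} [Fintype ι] {f g : ι → ι → ℕ}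
    (h : ∀ a b, f a b + f b a = g a b + g b a) : ∑ a, ∑ b, f a b = ∑ a, ∑ b, g a b := by
  have hf := Finset.sum_comm (s := Finset.univ) (t := Finset.univ) (f := f)
  have hg := Finset.sum_comm (s := Finset.univ) (t := Finset.univ) (f := g)
  have : ∑ a, ∑ b, (f a b + f b a) = ∑ a, ∑ b, (g a b + g b a) := by simp only [h]
  simp only [Finset.sum_add_distrib] at this
  omega

theorem sum_ncard_eq_sum_card_filter {ι α : Type*} [Fintype ι] (X : Finset α)
    (P : ι → α → Prop) [∀ t, DecidablePred (P t)] :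
    ∑ x ∈ X, Set.ncard {t | P t x} = ∑ t, (X.filter (P t)).card := by
  simp only [Finset.card_filter]
  rw [Finset.sum_comm]
  refine Finset.sum_congr rfl fun x _ => ?_
  rw [← Finset.card_filter, ← Set.ncard_coe_finset]
  simp

/-- The number of elements of `H(λ)` (with multiplicity) congruent to `0` mod `e` equals
`∑_c ∑_{x ∈ X^c} ∑_{k ≥ 0} N_k(x)`. -/
theorem stmt2 (l : ℕ) (hl : 1 ≤ l) (e : ℕ) (he : 1 < e)
    (lam : Fin l → IntPartition) (s : Fin l → ℤ)
    (hchain : ∀ c d : Fin l, c ≤ d → s c ≤ s d)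
    (hband : s ⟨l - 1, by omega⟩ ≤ s ⟨0, by omega⟩ + e)
    (m : ℕ) (hm : 0 < m)
    (hms : ∀ c, 1 ≤ (m : ℤ) + s c)
    (hzero : ∀ c, (lam c).part (((m : ℤ) + s c).toNat - 1) = 0) :
    Set.ncard {x : Fin l × Fin l × ℕ × ℕ |
        x.2.2.2 < (lam x.1).part x.2.2.1 ∧
          (e : ℤ) ∣ chargedHook lam s x.1 x.2.1 x.2.2.1 x.2.2.2}
      = ∑ c : Fin l, ∑ x ∈ betaFinset (lam c) (s c) m,
          ∑ᶠ k : ℕ,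
            (if k = 0 then
              Set.ncard {t : Fin l | c < t ∧ x ∉ betaFinset (lam t) (s t) m}
            else
              Set.ncard {t : Fin l |
                x - (k : ℤ) * e ∉ betaFinset (lam t) (s t) m ∧ -(m : ℤ) < x - (k : ℤ) * e}) := by
  classical
  set A : Fin l → Fin l → ℤ → ℕ := fun a b v => hookCount (lam a) (lam b) (s a) (s b) v with hA
  set B : Fin l → Fin l → ℕ → ℕ := fun a b k =>
    (pairFinset (lam a) (lam b) (s a) (s b) m ((k : ℤ) * e)).card with hB
  have hsum : ∀ a b : Fin l, ∃ K₀ : ℕ, ∀ K, K₀ ≤ K →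
      Set.ncard {y : ℕ × ℕ | y.2 < (lam a).part y.1 ∧ (e : ℤ) ∣ chargedHook lam s a b y.1 y.2} =
        A a b 0 + ∑ k ∈ Finset.range K, (A a b ((k + 1 : ℕ) * e) + A a b (-((k + 1 : ℕ) * e))) :=
    fun a b => exists_forall_ncard_dvd_eq_sum (lam a) (lam b) (s a) (s b) (by omega)
  choose K₀ hK₀ using hsum
  set K : ℕ := ∑ a, ∑ b, K₀ a b +
    ∑ c, ∑ x ∈ betaFinset (lam c) (s c) m, (x + m).natAbs with hK
  have hK₁ : ∀ a b, K₀ a b ≤ K := fun a b => by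
    have h₁ : K₀ a b ≤ ∑ b, K₀ a b :=
      Finset.single_le_sum (f := fun b => K₀ a b) (fun _ _ => Nat.zero_le _) (Finset.mem_univ b)
    have h₂ : ∑ b, K₀ a b ≤ ∑ a, ∑ b, K₀ a b :=
      Finset.single_le_sum (f := fun a => ∑ b, K₀ a b) (fun _ _ => Nat.zero_le _)
        (Finset.mem_univ a)
    omega
  have hK₂ : ∀ c, ∀ x ∈ betaFinset (lam c) (s c) m, x + m ≤ K := fun c x hx => by
    have h₁ := Finset.single_le_sum (f := fun x : ℤ => (x + m).natAbs)
      (fun _ _ => Nat.zero_le _) hx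
    have h₂ := Finset.single_le_sum
      (f := fun c => ∑ x ∈ betaFinset (lam c) (s c) m, (x + m).natAbs)
      (fun _ _ => Nat.zero_le _) (Finset.mem_univ c)
    omega
  have hband' : ∀ a b, s a ≤ s b + e := fun a b => by
    have h₁ := hchain a ⟨l - 1, by omega⟩ (Fin.le_def.2 (by simp only; omega))
    have h₂ := hchain ⟨0, by omega⟩ b (Fin.le_def.2 (by simp))
    omega
  have hpos : ∀ (a b : Fin l) (k : ℕ),
      A a b ((k + 1 : ℕ) * e) + A b a (-((k + 1 : ℕ) * e)) = B a b (k + 1) := fun a b k => by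
    have h₁ := hband' a b
    have h₂ : (e : ℤ) ≤ ((k + 1 : ℕ) : ℤ) * e := by
      push_cast
      nlinarith
    exact hookCount_add_hookCount_neg (hms a) (hzero a) (hms b) (hzero b) (by omega) (by omega)
  have hnull : ∀ a b : Fin l, a ≤ b → A a b 0 + A b a 0 = B a b 0 := fun a b hab => by
    have h₁ := hchain a b hab
    simpa [hA, hB] using hookCount_add_hookCount_neg (hms a) (hzero a) (hms b) (hzero b)
      (v := 0) le_rfl (by omega)
  have hdiag : ∀ a, B a a 0 = 0 := fun a => by
    simp only [hB, pairFinset, Finset.card_eq_zero, Finset.filter_eq_empty_iff]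
    intro x hx
    simp [hx]
  have hleft : Set.ncard {x : Fin l × Fin l × ℕ × ℕ |
        x.2.2.2 < (lam x.1).part x.2.2.1 ∧
          (e : ℤ) ∣ chargedHook lam s x.1 x.2.1 x.2.2.1 x.2.2.2} =
      ∑ a, ∑ b, (A a b 0 +
        ∑ k ∈ Finset.range K, (A a b ((k + 1 : ℕ) * e) + A a b (-((k + 1 : ℕ) * e)))) := by
    rw [ncard_setOf_pair_eq_sum (fun a b (y : ℕ × ℕ) =>
      y.2 < (lam a).part y.1 ∧ (e : ℤ) ∣ chargedHook lam s a b y.1 y.2)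
      (fun a b => (lam a).finite_nodes.subset fun y hy => hy.1)]
    exact Finset.sum_congr rfl fun a _ => Finset.sum_congr rfl fun b _ => hK₀ a b K (hK₁ a b)
  rw [hleft]
  have hright : ∀ c : Fin l, ∑ x ∈ betaFinset (lam c) (s c) m,
          ∑ᶠ k : ℕ,
            (if k = 0 then
              Set.ncard {t : Fin l | c < t ∧ x ∉ betaFinset (lam t) (s t) m}
            else
              Set.ncard {t : Fin l |
                x - (k : ℤ) * e ∉ betaFinset (lam t) (s t) m ∧ -(m : ℤ) < x - (k : ℤ) * e}) =
      ∑ t, ((if c < t then B c t 0 else 0) + ∑ k ∈ Finset.range K, B c t (k + 1)) := by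
    intro c
    have hfin : ∀ x ∈ betaFinset (lam c) (s c) m, (∑ᶠ k : ℕ,
            (if k = 0 then
              Set.ncard {t : Fin l | c < t ∧ x ∉ betaFinset (lam t) (s t) m}
            else
              Set.ncard {t : Fin l |
                x - (k : ℤ) * e ∉ betaFinset (lam t) (s t) m ∧ -(m : ℤ) < x - (k : ℤ) * e})) =
        (∑ k ∈ Finset.range K, Set.ncard {t : Fin l |
          x - ((k + 1 : ℕ) : ℤ) * e ∉ betaFinset (lam t) (s t) m ∧
            -(m : ℤ) < x - ((k + 1 : ℕ) : ℤ) * e}) +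
          Set.ncard {t : Fin l | c < t ∧ x ∉ betaFinset (lam t) (s t) m} := by
      intro x hx
      rw [finsum_eq_sum_of_support_subset (s := Finset.range (K + 1)), Finset.sum_range_succ']
      · simp only [Nat.add_eq_zero_iff, one_ne_zero, and_false, if_false, if_true]
      · intro k hk
        rw [Finset.coe_range, Set.mem_Iio]
        by_contra! hle
        have hxK := hK₂ c x hx
        have hmul : (k : ℤ) ≤ (k : ℤ) * e := by nlinarith
        refine hk ?_
        simp only
        rw [if_neg (by omega), Set.ncard_eq_zero, Set.eq_empty_iff_forall_notMem]
        rintro t ⟨-, ht⟩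
        omega
    rw [Finset.sum_congr rfl hfin, Finset.sum_add_distrib, Finset.sum_comm,
      Finset.sum_add_distrib, add_comm]
    congr 1
    · rw [sum_ncard_eq_sum_card_filter (betaFinset (lam c) (s c) m)
        (fun t x => c < t ∧ x ∉ betaFinset (lam t) (s t) m)]
      refine Finset.sum_congr rfl fun t _ => ?_
      split_ifs with hct
      · simp only [hB, pairFinset]
        congr 1
        refine Finset.filter_congr fun x hx => ?_
        have := neg_lt_of_mem_betaFinset hx
        simp [hct, this]
      · simp [hct]
    · refine Eq.trans (Finset.sum_congr rfl fun k _ => ?_) Finset.sum_comm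
      exact sum_ncard_eq_sum_card_filter (betaFinset (lam c) (s c) m)
        (fun t x => x - ((k + 1 : ℕ) : ℤ) * e ∉ betaFinset (lam t) (s t) m ∧
            -(m : ℤ) < x - ((k + 1 : ℕ) : ℤ) * e)
  rw [Finset.sum_congr rfl fun c _ => hright c]
  apply sum_sum_eq_of_add_swap_eq
  have hle : ∀ a b : Fin l, a ≤ b →
      (A a b 0 + ∑ k ∈ Finset.range K, (A a b ((k + 1 : ℕ) * e) + A a b (-((k + 1 : ℕ) * e)))) +
      (A b a 0 + ∑ k ∈ Finset.range K, (A b a ((k + 1 : ℕ) * e) + A b a (-((k + 1 : ℕ) * e)))) =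
      ((if a < b then B a b 0 else 0) + ∑ k ∈ Finset.range K, B a b (k + 1)) +
      ((if b < a then B b a 0 else 0) + ∑ k ∈ Finset.range K, B b a (k + 1)) := by
    intro a b hab
    have h₁ := hnull a b hab
    have h₂ : B a b 0 = (if a < b then B a b 0 else 0) + (if b < a then B b a 0 else 0) := by
      rcases hab.eq_or_lt with rfl | hlt
      · simp [hdiag]
      · simp [hlt, hlt.not_gt]
    simp only [← hpos, Finset.sum_add_distrib]
    omega
  intro a b
  rcases le_total a b with h | h
  · exact hle a b h
  · rw [add_comm, hle b a h, add_comm]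
end

section
/- Let l ≥ 1, e ∈ ℤ_{>1}, let λ = (λ^0,…,λ^{l−1}) be an l-partition of n and s = (s_0,…,s_{l−1}) ∈ ℤ^l. Then Fayers' weight p_{(e,s)}(λ) equals 0 (i.e., λ is an (e,s)-core) if and only if the e-th cyclotomic polynomial Φ_e(y) does not divide the Schur element s_λ(y) in ℚ[y,y^{−1}] (where divisibility of 0 by Φ_e holds by convention, so if s_λ(y) = 0 then λ is not an (e,s)-core). -/
/-- `resCount e lam s v` is `c_{v mod e}(λ)`: the number of nodes of the `l`-partition `λ`
whose `s`-charged content `c − r + s_a` is congruent to `v` modulo `e`. -/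
noncomputable def resCount (e : ℕ) {l : ℕ} (lam : Fin l → IntPartition) (s : Fin l → ℤ)
    (v : ℤ) : ℕ :=
  Set.ncard {x : Fin l × ℕ × ℕ | x.2.2 < (lam x.1).part x.2.1 ∧
    (e : ℤ) ∣ ((x.2.2 : ℤ) - x.2.1 + s x.1 - v)}

/-- `[h]_y = 1 + y + ⋯ + y^{h−1}` as a Laurent polynomial over `ℚ`. -/
noncomputable def yInt (h : ℤ) : LaurentPolynomial ℚ :=
  ∑ r ∈ Finset.range h.toNat, LaurentPolynomial.T (r : ℤ)

/-- `N(λ̄)` for the partition `λ̄` obtained by reordering all parts of the `l`-partition `λ`: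
`N(λ̄) = ∑_{k ≥ 1} binom(λ̄'_k, 2)` where `λ̄'_k = ∑_a (λ^a)'_k`. -/
noncomputable def nStatBar {l : ℕ} (lam : Fin l → IntPartition) : ℕ :=
  ∑ᶠ k : ℕ, Nat.choose (∑ a : Fin l, (lam a).conj k) 2

/-- The Schur element
`s_λ(y) = (−1)^{n(l−1)} y^{−N(λ̄)} ∏_a ∏_{(i,j) ∈ [λ^a]}
  ([h^{λ^a,λ^a}_{i,j}]_y ∏_{b ≠ a} (y^{ch^{a,b}_{i,j}} − 1))`
viewed in `ℚ[y,y⁻¹]`. -/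
noncomputable def schurElt (l n : ℕ) (lam : Fin l → IntPartition) (s : Fin l → ℤ) :
    LaurentPolynomial ℚ :=
  (-1) ^ (n * (l - 1)) *
    LaurentPolynomial.T (-(nStatBar lam : ℤ)) *
    ∏ᶠ (a : Fin l) (i : ℕ) (j : ℕ) (_ : j < (lam a).part i),
      (yInt (hookLen (lam a) (lam a) i j) *
        ∏ b ∈ Finset.univ.erase a, (LaurentPolynomial.T (chargedHook lam s a b i j) - 1))

/-- Fayers' weight of the `l`-partition `λ` attached to `(e,s)`:
`p_{(e,s)}(λ) = ∑_a c_{s_a mod e}(λ) − (1/2) ∑_{i ∈ ℤ/eℤ} (c_i(λ) − c_{i−1}(λ))²`. -/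
noncomputable def fayersWeight (e : ℕ) {l : ℕ} (lam : Fin l → IntPartition)
    (s : Fin l → ℤ) : ℚ :=
  ∑ a : Fin l, (resCount e lam s (s a) : ℚ)
    - (1 / 2) * ∑ i ∈ Finset.range e,
        ((resCount e lam s (i : ℤ) : ℚ) - (resCount e lam s ((i : ℤ) - 1) : ℚ)) ^ 2

open Finset

namespace IntPartition

/-- `p.nodes N` is the Young diagram of `p`, restricted to the first `N` rows. -/
def nodes (p : IntPartition) (N : ℕ) : Finset (Σ _ : ℕ, ℕ) :=
  (range N).sigma fun i => range (p.part i)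

theorem lt_conj_iff_s5 (p : IntPartition) (i k : ℕ) : i < p.conj k ↔ k < p.part i := by
  have hfin : {i : ℕ | k < p.part i}.Finite := by
    obtain ⟨N, hN⟩ := p.eventually_zero
    refine (Set.finite_Iio N).subset fun i (hi : k < p.part i) => ?_
    by_contra h
    have := hN i (not_lt.mp h)
    omega
  unfold conj
  constructor
  · intro h
    by_contra hk
    have hsub : {i : ℕ | k < p.part i} ⊆ Set.Iio i := by
      intro r (hr : k < p.part r)
      by_contra h'
      have := p.antitone (not_lt.mp h')
      omega
    have := Set.ncard_le_ncard hsub (Set.finite_Iio i)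
    simp at this
    omega
  · intro h
    have hsub : Set.Iic i ⊆ {i : ℕ | k < p.part i} :=
      fun r hr => lt_of_lt_of_le h (p.antitone hr)
    have := Set.ncard_le_ncard hsub hfin
    simp at this
    omega

/-- The gaps `j - λ'_j + 1` with `j < m` complement the beads of the partition truncated to its
first `m` columns. -/
theorem sum_gaps_add_sum_beads {M : Type*} [AddCommGroup M] (p : IntPartition) {N : ℕ}
    (hN : ∀ i, N ≤ i → p.part i = 0) (g : ℤ → M) (m : ℕ) :
    ∑ j ∈ range m, g ((j : ℤ) - p.conj j + 1) + ∑ r ∈ range N, g ((min (p.part r) m : ℕ) - (r : ℤ))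
      = ∑ j ∈ range m, g ((j : ℤ) + 1) + ∑ r ∈ range N, g (-(r : ℤ)) := by
  induction m with
  | zero => simp
  | succ m ih =>
    have hc : p.conj m ≤ N := by
      by_contra h
      have := (p.lt_conj_iff_s5 N m).mp (by omega)
      have := hN N le_rfl
      omega
    have hlow : ∑ r ∈ range (p.conj m), (g ((min (p.part r) (m + 1) : ℕ) - (r : ℤ))
        - g ((min (p.part r) m : ℕ) - (r : ℤ))) = g ((m : ℤ) + 1) - g ((m : ℤ) - p.conj m + 1) := by
      have : ∀ r ∈ range (p.conj m), (g ((min (p.part r) (m + 1) : ℕ) - (r : ℤ))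
          - g ((min (p.part r) m : ℕ) - (r : ℤ)))
          = (fun r : ℕ => g ((m : ℤ) + 1 - r)) r - (fun r : ℕ => g ((m : ℤ) + 1 - r)) (r + 1) := by
        intro r hr
        have hr' := (p.lt_conj_iff_s5 r m).mp (mem_range.mp hr)
        rw [min_eq_right (by omega), min_eq_right (by omega)]
        push_cast
        congr 2
        ring
      rw [sum_congr rfl this, sum_range_sub']
      simp only [Nat.cast_zero, sub_zero]
      congr 2
      ring
    have hstep : ∑ r ∈ range N, (g ((min (p.part r) (m + 1) : ℕ) - (r : ℤ))
        - g ((min (p.part r) m : ℕ) - (r : ℤ))) = g ((m : ℤ) + 1) - g ((m : ℤ) - p.conj m + 1) := by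
      rw [← hlow]
      symm
      refine sum_subset (range_subset_range.mpr hc) fun r _ hr => ?_
      have : ¬ m < p.part r := fun h => hr (mem_range.mpr ((p.lt_conj_iff_s5 r m).mpr h))
      rw [min_eq_left (by omega), min_eq_left (by omega), sub_self]
    rw [sum_sub_distrib, sub_eq_iff_eq_add] at hstep
    rw [sum_range_succ, sum_range_succ, hstep]
    calc _ = (∑ j ∈ range m, g ((j : ℤ) - p.conj j + 1)
          + ∑ r ∈ range N, g ((min (p.part r) m : ℕ) - (r : ℤ))) + g ((m : ℤ) + 1) := by abel
      _ = _ := by rw [ih]; abel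

/-- The hook lengths in a row of `p` with respect to `q`. -/
theorem sum_row_hookLen {M : Type*} [AddCommGroup M] (p q : IntPartition) {N : ℕ}
    (hq : ∀ i, N ≤ i → q.part i = 0) (f : ℤ → M) (i : ℕ) :
    ∑ j ∈ range (p.part i), f (hookLen p q i j)
      = ∑ j ∈ range (p.part i), f ((j : ℤ) - i)
        + ∑ r ∈ range N, f ((p.part i : ℤ) - i + r)
        - ∑ r ∈ range N, f ((p.part i : ℤ) - i + r - (min (q.part r) (p.part i) : ℕ)) := by
  have h := q.sum_gaps_add_sum_beads hq (fun x => f ((p.part i : ℤ) - i - x)) (p.part i)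
  rw [← eq_sub_iff_add_eq] at h
  rw [← sum_range_reflect (fun j => f ((j : ℤ) - i))]
  refine Eq.trans (sum_congr rfl fun j _ => ?_) (h.trans (congrArg₂ _ (congrArg₂ _
    (sum_congr rfl fun j hj => ?_) (sum_congr rfl fun r _ => ?_)) (sum_congr rfl fun r _ => ?_)))
  · rw [hookLen]; congr 1; ring
  · have := mem_range.mp hj
    congr 1; omega
  · congr 1; ring
  · congr 1; ring

/-- The mixed second difference of `f (u - v + d)` telescopes over a rectangle. -/
theorem sum_range_sum_range_second_difference (f : ℤ → ℚ) (d : ℤ) (m n : ℕ) :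
    ∑ j ∈ range m, ∑ k ∈ range n,
        (2 * f ((j : ℤ) - k + d) - f ((j : ℤ) - k + d + 1) - f ((j : ℤ) - k + d - 1))
      = f ((m : ℤ) - n + d) - f ((m : ℤ) + d) - f (d - n) + f d := by
  have inner : ∀ j : ℕ, ∑ k ∈ range n,
        (2 * f ((j : ℤ) - k + d) - f ((j : ℤ) - k + d + 1) - f ((j : ℤ) - k + d - 1))
      = (f (((j + 1 : ℕ) : ℤ) - n + d) - f (((j + 1 : ℕ) : ℤ) + d))
        - (f ((j : ℤ) - n + d) - f ((j : ℤ) + d)) := by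
    intro j
    have := sum_range_sub (fun k : ℕ => f (((j + 1 : ℕ) : ℤ) - k + d) - f ((j : ℤ) - k + d)) n
    simp only [Nat.cast_zero, sub_zero] at this
    rw [show ∀ a b c d : ℚ, (a - b) - (c - d) = (a - c) - (b - d) by intros; ring, ← this]
    refine sum_congr rfl fun k _ => ?_
    push_cast
    rw [show (j : ℤ) + 1 - (k + 1) + d = j - k + d by ring,
      show (j : ℤ) + 1 - k + d = j - k + d + 1 by ring,
      show (j : ℤ) - (k + 1) + d = j - k + d - 1 by ring]
    ring
  rw [sum_congr rfl fun j _ => inner j,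
    sum_range_sub (fun j : ℕ => f ((j : ℤ) - n + d) - f ((j : ℤ) + d))]
  simp only [Nat.cast_zero, zero_sub, zero_add]
  rw [show -(n : ℤ) + d = d - n by ring]
  ring

/-- Hook lengths of a pair of partitions in terms of contents. -/
theorem sum_hookLen_add_sum_neg_hookLen (p q : IntPartition) {N : ℕ}
    (hp : ∀ i, N ≤ i → p.part i = 0) (hq : ∀ i, N ≤ i → q.part i = 0) (f : ℤ → ℚ) :
    ∑ x ∈ p.nodes N, f (hookLen p q x.1 x.2) + ∑ y ∈ q.nodes N, f (-hookLen q p y.1 y.2)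
      = ∑ x ∈ p.nodes N, f ((x.2 : ℤ) - x.1) + ∑ y ∈ q.nodes N, f (-((y.2 : ℤ) - y.1))
        - ∑ x ∈ p.nodes N, ∑ y ∈ q.nodes N,
          (2 * f (((x.2 : ℤ) - x.1) - ((y.2 : ℤ) - y.1))
            - f (((x.2 : ℤ) - x.1) - ((y.2 : ℤ) - y.1) + 1)
            - f (((x.2 : ℤ) - x.1) - ((y.2 : ℤ) - y.1) - 1)) := by
  have hdouble : ∑ x ∈ p.nodes N, ∑ y ∈ q.nodes N,
          (2 * f (((x.2 : ℤ) - x.1) - ((y.2 : ℤ) - y.1))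
            - f (((x.2 : ℤ) - x.1) - ((y.2 : ℤ) - y.1) + 1)
            - f (((x.2 : ℤ) - x.1) - ((y.2 : ℤ) - y.1) - 1))
      = ∑ i ∈ range N, ∑ r ∈ range N,
        (f ((p.part i : ℤ) - q.part r + (r - i)) - f ((p.part i : ℤ) + (r - i))
          - f ((r - i : ℤ) - q.part r) + f (r - i)) := by
    simp only [nodes, sum_sigma]
    refine sum_congr rfl fun i _ => ?_
    rw [sum_comm]
    refine sum_congr rfl fun r _ => ?_
    rw [← sum_range_sum_range_second_difference]
    refine sum_congr rfl fun j _ => sum_congr rfl fun k _ => ?_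
    rw [show (j : ℤ) - i - (k - r) = j - k + (r - i) by ring]
  rw [hdouble]
  simp only [nodes, sum_sigma]
  rw [sum_congr rfl fun i _ => p.sum_row_hookLen q hq f i,
    sum_congr rfl fun r _ => q.sum_row_hookLen p hp (fun x => f (-x)) r]
  simp only [sum_add_distrib, sum_sub_distrib]
  have hmin : ∑ i ∈ range N, ∑ r ∈ range N,
        f ((p.part i : ℤ) - i + r - (min (q.part r) (p.part i) : ℕ))
      + ∑ r ∈ range N, ∑ i ∈ range N,
        f (-((q.part r : ℤ) - r + i - (min (p.part i) (q.part r) : ℕ)))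
      = ∑ i ∈ range N, ∑ r ∈ range N, f ((p.part i : ℤ) - q.part r + (r - i))
        + ∑ i ∈ range N, ∑ r ∈ range N, f (r - i) := by
    rw [sum_comm (s := range N) (t := range N)
      (f := fun r i => f (-((q.part r : ℤ) - r + i - (min (p.part i) (q.part r) : ℕ))))]
    simp only [← sum_add_distrib]
    refine sum_congr rfl fun i _ => sum_congr rfl fun r _ => ?_
    rcases le_total (p.part i) (q.part r) with h | h
    · rw [min_eq_right h, min_eq_left h, add_comm]
      congr 2 <;> ring
    · rw [min_eq_left h, min_eq_right h]
      congr 2 <;> ring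
  have hleft : ∑ i ∈ range N, ∑ r ∈ range N, f ((p.part i : ℤ) - i + r)
      = ∑ i ∈ range N, ∑ r ∈ range N, f ((p.part i : ℤ) + (r - i)) :=
    sum_congr rfl fun i _ => sum_congr rfl fun r _ => by congr 1; ring
  have hright : ∑ r ∈ range N, ∑ i ∈ range N, f (-((q.part r : ℤ) - r + i))
      = ∑ i ∈ range N, ∑ r ∈ range N, f ((r - i : ℤ) - q.part r) := by
    rw [sum_comm]
    exact sum_congr rfl fun i _ => sum_congr rfl fun r _ => by congr 1; ring
  linarith

end IntPartition

/-- The indicator function of the multiples of `e`. -/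
def dvdInd (e : ℕ) (x : ℤ) : ℚ := if (e : ℤ) ∣ x then 1 else 0

theorem dvdInd_nonneg (e : ℕ) (x : ℤ) : 0 ≤ dvdInd e x := by
  unfold dvdInd; split_ifs <;> simp

theorem dvdInd_eq_zero_iff (e : ℕ) (x : ℤ) : dvdInd e x = 0 ↔ ¬ (e : ℤ) ∣ x := by
  unfold dvdInd; split_ifs <;> simp_all

theorem dvdInd_neg (e : ℕ) (x : ℤ) : dvdInd e (-x) = dvdInd e x := by
  simp [dvdInd]

theorem sum_dvdInd_mul_dvdInd {e : ℕ} (he : 0 < e) (x y : ℤ) :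
    ∑ v ∈ range e, dvdInd e (x - v) * dvdInd e (y - v) = dvdInd e (x - y) := by
  have he' : (0 : ℤ) < e := by exact_mod_cast he
  have hpos := Int.emod_nonneg x he'.ne'
  have hlt := Int.emod_lt_of_pos x he'
  have hx : (e : ℤ) ∣ x - ((x % e).toNat : ℤ) := by
    rw [Int.toNat_of_nonneg hpos]
    exact Int.dvd_self_sub_emod
  rw [sum_eq_single_of_mem (x % e).toNat (mem_range.mpr (by omega))]
  · have : (e : ℤ) ∣ y - ((x % e).toNat : ℤ) ↔ (e : ℤ) ∣ x - y := by
      rw [← dvd_sub_right (a := (e : ℤ)) hx]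
      ring_nf
    simp only [dvdInd, hx, this, if_true, one_mul]
  · intro v hv hne
    have : ¬ (e : ℤ) ∣ x - v := by
      intro h
      apply hne
      have h1 : (e : ℤ) ∣ (v : ℤ) - ((x % e).toNat : ℤ) := by
        have := dvd_sub hx h
        simpa using this
      have hv' := mem_range.mp hv
      have := Int.eq_zero_of_abs_lt_dvd h1 (by rw [abs_lt]; constructor <;> omega)
      omega
    rw [(dvdInd_eq_zero_iff e _).mpr this, zero_mul]

theorem sum_dvdInd_difference_mul {e : ℕ} (he : 0 < e) (x y : ℤ) :
    ∑ v ∈ range e, (dvdInd e (x - v) - dvdInd e (x - (v - 1)))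
        * (dvdInd e (y - v) - dvdInd e (y - (v - 1)))
      = 2 * dvdInd e (x - y) - dvdInd e (x - y + 1) - dvdInd e (x - y - 1) := by
  have h (z : ℤ) (v : ℕ) : z - ((v : ℤ) - 1) = z + 1 - v := by ring
  simp only [h, sub_mul, mul_sub, sum_sub_distrib, sum_dvdInd_mul_dvdInd he]
  rw [show x - (y + 1) = x - y - 1 by ring, show x + 1 - y = x - y + 1 by ring,
    show x + 1 - (y + 1) = x - y by ring]
  ring

section Multipartition

variable {l : ℕ} (lam : Fin l → IntPartition) (s : Fin l → ℤ)

theorem resCount_eq_sum (e : ℕ) {N : ℕ} (hN : ∀ a i, N ≤ i → (lam a).part i = 0) (v : ℤ) :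
    (resCount e lam s v : ℚ)
      = ∑ a, ∑ x ∈ (lam a).nodes N, dvdInd e ((x.2 : ℤ) - x.1 + s a - v) := by
  have hset : {x : Fin l × ℕ × ℕ | x.2.2 < (lam x.1).part x.2.1 ∧
      (e : ℤ) ∣ ((x.2.2 : ℤ) - x.2.1 + s x.1 - v)}
      = (((univ : Finset (Fin l)).sigma fun a => ((lam a).nodes N).filter fun x =>
          (e : ℤ) ∣ ((x.2 : ℤ) - x.1 + s a - v)).image
          fun y => ((y.1, y.2.1, y.2.2) : Fin l × ℕ × ℕ) : Finset _) := by
    ext ⟨a, i, j⟩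
    simp only [Set.mem_ofPred_eq, coe_image, Set.mem_image, mem_coe, mem_sigma, mem_univ, true_and,
      mem_filter, IntPartition.nodes, mem_range, Prod.mk.injEq]
    constructor
    · rintro ⟨h1, h2⟩
      refine ⟨⟨a, ⟨i, j⟩⟩, ⟨⟨?_, h1⟩, h2⟩, rfl, rfl, rfl⟩
      by_contra h
      have := hN a i (not_lt.mp h)
      omega
    · rintro ⟨⟨a', ⟨i', j'⟩⟩, ⟨⟨_, h1⟩, h2⟩, rfl, rfl, rfl⟩
      exact ⟨h1, h2⟩
  rw [resCount, hset, Set.ncard_coe_finset, card_image_of_injective, card_sigma, Nat.cast_sum]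
  · simp only [dvdInd, sum_boole]
  · rintro ⟨a, ⟨i, j⟩⟩ ⟨a', ⟨i', j'⟩⟩ h
    simp only [Prod.mk.injEq] at h
    obtain ⟨rfl, rfl, rfl⟩ := h
    rfl

theorem sum_chargedHook_add_sum_chargedHook (e : ℕ) {N : ℕ}
    (hN : ∀ a i, N ≤ i → (lam a).part i = 0) (a b : Fin l) :
    ∑ x ∈ (lam a).nodes N, dvdInd e (chargedHook lam s a b x.1 x.2)
        + ∑ y ∈ (lam b).nodes N, dvdInd e (chargedHook lam s b a y.1 y.2)
      = ∑ x ∈ (lam a).nodes N, dvdInd e ((x.2 : ℤ) - x.1 + s a - s b)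
        + ∑ y ∈ (lam b).nodes N, dvdInd e ((y.2 : ℤ) - y.1 + s b - s a)
        - ∑ x ∈ (lam a).nodes N, ∑ y ∈ (lam b).nodes N,
          (2 * dvdInd e (((x.2 : ℤ) - x.1 + s a) - ((y.2 : ℤ) - y.1 + s b))
            - dvdInd e (((x.2 : ℤ) - x.1 + s a) - ((y.2 : ℤ) - y.1 + s b) + 1)
            - dvdInd e (((x.2 : ℤ) - x.1 + s a) - ((y.2 : ℤ) - y.1 + s b) - 1)) := by
  have h := (lam a).sum_hookLen_add_sum_neg_hookLen (lam b) (hN a) (hN b)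
    (fun x => dvdInd e (x + s a - s b))
  refine Eq.trans (congrArg₂ _ rfl (sum_congr rfl fun y _ => ?_)) (h.trans (congrArg₂ _
    (congrArg₂ _ rfl (sum_congr rfl fun y _ => ?_))
    (sum_congr rfl fun x _ => sum_congr rfl fun y _ => ?_)))
  · rw [← dvdInd_neg, chargedHook]; congr 1; ring
  · rw [← dvdInd_neg]; congr 1; ring
  · refine congrArg₂ _ (congrArg₂ _ (congrArg _ (congrArg _ ?_)) (congrArg _ ?_))
      (congrArg _ ?_) <;> ring

/-- Fayers' weight counts the charged hook lengths divisible by `e`. -/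
theorem fayersWeight_eq_sum {e : ℕ} (he : 0 < e) {N : ℕ}
    (hN : ∀ a i, N ≤ i → (lam a).part i = 0) :
    fayersWeight e lam s
      = ∑ a, ∑ b, ∑ x ∈ (lam a).nodes N, dvdInd e (chargedHook lam s a b x.1 x.2) := by
  have hsq : ∑ i ∈ range e,
        ((resCount e lam s (i : ℤ) : ℚ) - (resCount e lam s ((i : ℤ) - 1) : ℚ)) ^ 2
      = ∑ a, ∑ b, ∑ x ∈ (lam a).nodes N, ∑ y ∈ (lam b).nodes N,
          (2 * dvdInd e (((x.2 : ℤ) - x.1 + s a) - ((y.2 : ℤ) - y.1 + s b))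
            - dvdInd e (((x.2 : ℤ) - x.1 + s a) - ((y.2 : ℤ) - y.1 + s b) + 1)
            - dvdInd e (((x.2 : ℤ) - x.1 + s a) - ((y.2 : ℤ) - y.1 + s b) - 1)) := by
    simp only [resCount_eq_sum lam s e hN, ← sum_sub_distrib, sq, sum_mul_sum]
    rw [sum_comm]
    refine sum_congr rfl fun a _ => ?_
    rw [sum_comm]
    refine sum_congr rfl fun b _ => ?_
    rw [sum_comm]
    refine sum_congr rfl fun x _ => ?_
    rw [sum_comm]
    exact sum_congr rfl fun y _ => sum_dvdInd_difference_mul he _ _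
  have hpair : ∑ a, ∑ b, (∑ x ∈ (lam a).nodes N, dvdInd e (chargedHook lam s a b x.1 x.2)
        + ∑ y ∈ (lam b).nodes N, dvdInd e (chargedHook lam s b a y.1 y.2)) = _ :=
    sum_congr rfl fun a _ => sum_congr rfl fun b _ =>
      sum_chargedHook_add_sum_chargedHook lam s e hN a b
  simp only [sum_add_distrib, sum_sub_distrib] at hpair
  rw [sum_comm (f := fun a b => ∑ y ∈ (lam b).nodes N, dvdInd e (chargedHook lam s b a y.1 y.2)),
    sum_comm (f := fun a b => ∑ x ∈ (lam a).nodes N, dvdInd e ((x.2 : ℤ) - x.1 + s a - s b))]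
    at hpair
  simp only [sum_sub_distrib] at hsq
  rw [fayersWeight, hsq]
  simp only [resCount_eq_sum lam s e hN]
  linarith

theorem fayersWeight_eq_zero_iff {e : ℕ} (he : 0 < e) {N : ℕ}
    (hN : ∀ a i, N ≤ i → (lam a).part i = 0) :
    fayersWeight e lam s = 0 ↔ ∀ a b, ∀ i < N, ∀ j < (lam a).part i,
      ¬ (e : ℤ) ∣ chargedHook lam s a b i j := by
  rw [fayersWeight_eq_sum lam s he hN]
  have h0 := dvdInd_nonneg e
  rw [sum_eq_zero_iff_of_nonneg fun a _ => sum_nonneg fun b _ => sum_nonneg fun x _ => h0 _]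
  refine forall_congr' fun a => ?_
  rw [imp_iff_right (mem_univ a),
    sum_eq_zero_iff_of_nonneg fun b _ => sum_nonneg fun x _ => h0 _]
  refine forall_congr' fun b => ?_
  rw [imp_iff_right (mem_univ b), sum_eq_zero_iff_of_nonneg fun x _ => h0 _]
  simp only [dvdInd_eq_zero_iff, IntPartition.nodes, mem_sigma, mem_range, Sigma.forall, and_imp]
  exact forall_congr' fun i => ⟨fun h hi j => h j hi, fun h j hi => h hi j⟩

theorem schurElt_eq_prod (n : ℕ) {N : ℕ} (hN : ∀ a i, N ≤ i → (lam a).part i = 0) :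
    schurElt l n lam s = (-1) ^ (n * (l - 1)) * LaurentPolynomial.T (-(nStatBar lam : ℤ)) *
      ∏ a, ∏ i ∈ range N, ∏ j ∈ range ((lam a).part i),
        (yInt (hookLen (lam a) (lam a) i j) *
          ∏ b ∈ univ.erase a, (LaurentPolynomial.T (chargedHook lam s a b i j) - 1)) := by
  have hrow (a : Fin l) (i : ℕ) (F : ℕ → LaurentPolynomial ℚ) :
      ∏ᶠ (j : ℕ) (_ : j < (lam a).part i), F j = ∏ j ∈ range ((lam a).part i), F j := by
    simp only [← mem_range]
    exact finprod_mem_finset_eq_prod F _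
  rw [schurElt, finprod_eq_prod_of_fintype]
  congr 1
  refine prod_congr rfl fun a _ => ?_
  simp only [hrow]
  refine finprod_eq_prod_of_mulSupport_subset _ fun i hi => ?_
  rw [mem_coe, mem_range]
  by_contra h
  exact hi (by simp [hN a i (not_lt.mp h)])

end Multipartition

theorem IntPartition.hookLen_self_pos (p : IntPartition) {i j : ℕ} (h : j < p.part i) :
    0 < hookLen p p i j := by
  have := (p.lt_conj_iff_s5 i j).mpr h
  rw [hookLen]
  omega

theorem LaurentPolynomial.toLaurent_cyclotomic_dvd_iff {e : ℕ} (he : 0 < e) {ζ : ℂˣ}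
    (hζ : IsPrimitiveRoot (ζ : ℂ) e) (F : LaurentPolynomial ℚ) :
    Polynomial.toLaurent (Polynomial.cyclotomic e ℚ) ∣ F ↔
      LaurentPolynomial.eval₂ (algebraMap ℚ ℂ) ζ F = 0 := by
  constructor
  · rintro ⟨G, rfl⟩
    rw [map_mul, LaurentPolynomial.eval₂_toLaurent, Polynomial.cyclotomic_eq_minpoly_rat hζ he,
      ← Polynomial.aeval_def, minpoly.aeval, zero_mul]
  · intro h
    obtain ⟨n, f, hf⟩ := F.exists_T_pow
    have hroot : Polynomial.aeval (ζ : ℂ) f = 0 := by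
      rw [Polynomial.aeval_def, ← LaurentPolynomial.eval₂_toLaurent, hf, map_mul, h, zero_mul]
    have hdvd : Polynomial.cyclotomic e ℚ ∣ f := by
      rw [Polynomial.cyclotomic_eq_minpoly_rat hζ he]
      exact minpoly.dvd ℚ _ hroot
    have := map_dvd (Polynomial.toLaurent (R := ℚ)) hdvd
    rw [hf] at this
    exact ((LaurentPolynomial.isUnit_T n).dvd_mul_right).mp this

theorem eval₂_yInt_eq_zero_iff {e : ℕ} (he : 1 < e) {ζ : ℂˣ}
    (hζ : IsPrimitiveRoot (ζ : ℂ) e) {h : ℤ} (hh : 0 < h) :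
    LaurentPolynomial.eval₂ (algebraMap ℚ ℂ) ζ (yInt h) = 0 ↔ (e : ℤ) ∣ h := by
  have hne : (ζ : ℂ) - 1 ≠ 0 := sub_ne_zero.mpr (hζ.ne_one he)
  obtain ⟨k, rfl⟩ := Int.eq_ofNat_of_zero_le hh.le
  rw [yInt, map_sum, Int.toNat_natCast, Int.natCast_dvd_natCast, ← hζ.pow_eq_one_iff_dvd,
    ← sub_eq_zero (b := (1 : ℂ)), ← geom_sum_mul, mul_eq_zero, or_iff_left hne]
  simp [LaurentPolynomial.eval₂_T]

theorem eval₂_T_sub_one_eq_zero_iff {e : ℕ} {ζ : ℂˣ}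
    (hζ : IsPrimitiveRoot (ζ : ℂ) e) (h : ℤ) :
    LaurentPolynomial.eval₂ (algebraMap ℚ ℂ) ζ (LaurentPolynomial.T h - 1) = 0 ↔ (e : ℤ) ∣ h := by
  rw [map_sub, map_one, LaurentPolynomial.eval₂_T, sub_eq_zero, Units.val_zpow_eq_zpow_val,
    hζ.zpow_eq_one_iff_dvd]

/-- `λ` is an `(e,s)`-core (Fayers' weight zero) iff `Φ_e(y)` does not divide the Schur
element `s_λ(y)` in `ℚ[y,y⁻¹]`. -/
theorem stmt5 (l n : ℕ) (hl : 1 ≤ l) (e : ℕ) (he : 1 < e)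
    (lam : Fin l → IntPartition) (s : Fin l → ℤ)
    (hn : ∑ a : Fin l, (∑ᶠ i : ℕ, (lam a).part i) = n) :
    fayersWeight e lam s = 0 ↔
      ¬ (Polynomial.toLaurent (Polynomial.cyclotomic e ℚ) ∣ schurElt l n lam s) := by
  choose M hM using fun a => (lam a).eventually_zero
  have hN : ∀ a i, univ.sup M ≤ i → (lam a).part i = 0 := fun a i hi =>
    hM a i ((le_sup (f := M) (mem_univ a)).trans hi)
  obtain ⟨ζ, hζ⟩ : ∃ ζ : ℂˣ, IsPrimitiveRoot (ζ : ℂ) e :=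
    have h := Complex.isPrimitiveRoot_exp e (by omega)
    ⟨(h.isUnit (by omega)).unit, h⟩
  rw [fayersWeight_eq_zero_iff lam s (by omega) hN,
    LaurentPolynomial.toLaurent_cyclotomic_dvd_iff (by omega) hζ, schurElt_eq_prod lam s n hN]
  simp only [map_mul, map_prod, map_pow, map_neg, map_one, ← ne_eq, mul_ne_zero_iff,
    prod_ne_zero_iff, mem_univ, mem_range, mem_erase, true_implies, and_true]
  have hunit : (LaurentPolynomial.eval₂ (algebraMap ℚ ℂ) ζ)
      (LaurentPolynomial.T (-(nStatBar lam : ℤ))) ≠ 0 :=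
    ((LaurentPolynomial.isUnit_T _).map _).ne_zero
  rw [and_iff_right ⟨pow_ne_zero _ (by norm_num), hunit⟩]
  refine forall_congr' fun a => ?_
  constructor
  · intro h i hi j hj
    refine ⟨?_, fun b _ => ?_⟩
    · rw [ne_eq, eval₂_yInt_eq_zero_iff he hζ ((lam a).hookLen_self_pos hj)]
      simpa [chargedHook] using h a i hi j hj
    · rw [ne_eq, eval₂_T_sub_one_eq_zero_iff hζ]
      exact h b i hi j hj
  · intro h b i hi j hj
    obtain ⟨h1, h2⟩ := h i hi j hj
    rw [ne_eq, eval₂_yInt_eq_zero_iff he hζ ((lam a).hookLen_self_pos hj)] at h1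
    by_cases hb : b = a
    · subst hb
      simpa [chargedHook] using h1
    · have := h2 b hb
      rwa [ne_eq, eval₂_T_sub_one_eq_zero_iff hζ] at this
end
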